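/- For all fixed integers k ≥ 2 and l ≥ 2, there exists an l-clause Achlioptas rule for random k-SAT (in fact the rule: select the first among the first l−1 presented clauses that contains at least two positive literals, and otherwise select the l-th clause) such that for every ε > 0, the formula Φ_m generated after m = ⌊(r(k,l) − ε)·n⌋ steps is satisfiable with probability tending to 1 as n → ∞, where r(k,l) = 1 / ( ((k+1)/2^k)^{l−1}·(k/2^k) + 2·√( ((k+1)/2^k)^{l−1} · (1/2^k) · (1 − ((k+1)/2^k)^l) ) ). -/

import Mathlib

open Finset Filter

/-- A literal over `n` variables: a variable together with a sign (`true` = positive). -/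
abbrev Lit (n : ℕ) := Fin n × Bool

/-- A `k`-clause over `n` variables: a set of `k` literals on `k` distinct variables.
There are `C(n,k) * 2^k` such clauses. -/
abbrev Clause (n k : ℕ) :=
  {C : Finset (Lit n) // C.card = k ∧ (C.image Prod.fst).card = k}

/-- The number of positive literals in a clause. -/
def Clause.posCount {n k : ℕ} (C : Clause n k) : ℕ :=
  (C.1.filter fun p => p.2 = true).card

/-- The assignment `σ` satisfies the clause `C`. -/
def Sat {n k : ℕ} (σ : Fin n → Bool) (C : Clause n k) : Prop :=
  ∃ p ∈ C.1, σ p.1 = p.2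

/-- A formula (a finite sequence of clauses) is satisfiable. -/
def Satisfiable {n k m : ℕ} (Φ : Fin m → Clause n k) : Prop :=
  ∃ σ : Fin n → Bool, ∀ i, Sat σ (Φ i)

/-- The Achlioptas rule: select the first among the first `l - 1` presented clauses
containing at least two positive literals; if there is none, select the `l`-th clause. -/
def select {n k l : ℕ} (hl : 0 < l) (cs : Fin l → Clause n k) : Clause n k :=
  match (List.finRange l).find? (fun i => decide (i.1 + 1 < l ∧ 2 ≤ (cs i).posCount)) with
  | some i => cs i
  | none => cs ⟨l - 1, Nat.sub_lt hl one_pos⟩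

/-- The probability of the event `P` under the uniform distribution on the finite type `α`;
in particular, for `α = Fin m → Fin l → Clause n k` this is the probability that `P` holds
for `m` rounds of `l` clauses drawn independently and uniformly at random with replacement. -/
noncomputable def unifProb {α : Type*} [Fintype α] (P : α → Prop) : ℝ :=
  (Nat.card {a // P a} : ℝ) / (Fintype.card α : ℝ)

/-- The density `r(k,l)` from the paper. -/
noncomputable def rkl (k l : ℕ) : ℝ :=
  1 / ( ((k + 1 : ℝ) / 2 ^ k) ^ (l - 1) * (k / 2 ^ k)
    + 2 * Real.sqrt (((k + 1 : ℝ) / 2 ^ k) ^ (l - 1) * (1 / 2 ^ k)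
        * (1 - ((k + 1 : ℝ) / 2 ^ k) ^ l)) )

section basics
open Classical

lemma up_eq {α : Type*} [Fintype α] (P : α → Prop) [DecidablePred P] :
    unifProb P = ((univ.filter P).card : ℝ) / (Fintype.card α : ℝ) := by
  unfold unifProb
  rw [Nat.card_eq_fintype_card, Fintype.card_subtype]

lemma up_nonneg {α : Type*} [Fintype α] (P : α → Prop) : 0 ≤ unifProb P := by
  unfold unifProb; positivity

lemma up_mono {α : Type*} [Fintype α] {P Q : α → Prop} (h : ∀ a, P a → Q a) :
    unifProb P ≤ unifProb Q := by
  rw [up_eq, up_eq]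
  gcongr
  intro ha
  exact h _ ha

lemma up_union {α ι : Type*} [Fintype α] [Fintype ι] (P : ι → α → Prop) :
    unifProb (fun a => ∃ i, P i a) ≤ ∑ i, unifProb (P i) := by
  simp_rw [up_eq]
  rw [← Finset.sum_div]
  gcongr
  have : univ.filter (fun a => ∃ i, P i a) = univ.biUnion (fun i => univ.filter (P i)) := by
    ext a; simp
  rw [this]
  exact_mod_cast card_biUnion_le

lemma up_or {α : Type*} [Fintype α] (P Q : α → Prop) :
    unifProb (fun a => P a ∨ Q a) ≤ unifProb P + unifProb Q := by
  simp_rw [up_eq]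
  rw [← add_div]
  gcongr
  rw [filter_or]
  exact_mod_cast card_union_le _ _

lemma up_compl {α : Type*} [Fintype α] [Nonempty α] (P : α → Prop) :
    unifProb P = 1 - unifProb (fun a => ¬ P a) := by
  rw [up_eq, up_eq]
  have h := Finset.card_filter_add_card_filter_not (s := (univ : Finset α)) P
  have h0 : (Fintype.card α : ℝ) ≠ 0 := by
    exact_mod_cast Fintype.card_ne_zero
  rw [Finset.card_univ] at h
  have h' : ((univ.filter P).card : ℝ) + ((univ.filter (fun a => ¬ P a)).card : ℝ)
    = Fintype.card α := by exact_mod_cast h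
  field_simp
  linarith

lemma up_pi_all {α ι : Type*} [Fintype α] [Fintype ι] [DecidableEq ι] (Q : ι → α → Prop) :
    unifProb (fun A : ι → α => ∀ i, Q i (A i)) = ∏ i, unifProb (Q i) := by
  simp_rw [up_eq]
  rw [Finset.prod_div_distrib]
  have : univ.filter (fun A : ι → α => ∀ i, Q i (A i))
      = Fintype.piFinset (fun i => univ.filter (Q i)) := by
    ext A; simp [Fintype.mem_piFinset]
  rw [this, Fintype.card_piFinset]
  simp

lemma up_true {α : Type*} [Fintype α] [Nonempty α] : unifProb (fun _ : α => True) = 1 := by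
  rw [up_eq]
  have h0 : (Fintype.card α : ℝ) ≠ 0 := by
    exact_mod_cast Fintype.card_ne_zero
  simp [h0]

lemma up_pi_inj {α ι T : Type*} [Fintype α] [Nonempty α] [Fintype ι] [DecidableEq ι] [Fintype T]
    (f : T → ι) (hf : Function.Injective f) (Q : T → α → Prop) :
    unifProb (fun A : ι → α => ∀ t, Q t (A (f t))) = ∏ t, unifProb (Q t) := by
  have h1 : (fun A : ι → α => ∀ t, Q t (A (f t)))
      = (fun A : ι → α => ∀ i, (fun i a => ∀ t, f t = i → Q t a) i (A i)) := by
    funext A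
    apply propext
    constructor
    · intro h i t hti
      subst hti
      exact h t
    · intro h t
      exact h (f t) t rfl
  rw [h1, up_pi_all (fun i a => ∀ t, f t = i → Q t a)]
  have h2 : ∏ t, unifProb (Q t)
      = ∏ t, (fun i => unifProb (fun a => ∀ t, f t = i → Q t a)) (f t) := by
    apply Finset.prod_congr rfl
    intro t _
    simp only
    congr 1
    funext a
    apply propext
    constructor
    · intro h t' ht'
      rw [hf ht']; exact h
    · intro h
      exact h t rfl
  rw [h2, ← Finset.prod_image (s := univ) (g := f)
    (f := fun i => unifProb (fun a => ∀ t, f t = i → Q t a)) (fun a _ b _ h => hf h)]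
  symm
  apply Finset.prod_subset (subset_univ _)
  intro i _ hi
  have : (fun a : α => ∀ t, f t = i → Q t a) = fun _ => True := by
    funext a
    apply propext
    simp only [iff_true]
    intro t ht
    exact absurd (mem_image.2 ⟨t, mem_univ _, ht⟩) hi
  rw [this, up_true]

lemma up_prod_le {α β : Type*} [Fintype α] [Fintype β] (R : β → Prop) (Q : β → α → Prop)
    (c : ℝ) (h : ∀ b, R b → unifProb (Q b) ≤ c) :
    unifProb (fun x : α × β => R x.2 ∧ Q x.2 x.1) ≤ unifProb R * c := by
  have key : ((univ.filter (fun x : α × β => R x.2 ∧ Q x.2 x.1)).card : ℝ)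
      = ∑ b ∈ univ.filter R, ((univ.filter (Q b)).card : ℝ) := by
    have : (univ.filter (fun x : α × β => R x.2 ∧ Q x.2 x.1)).card
      = ∑ b ∈ univ.filter R, (univ.filter (Q b)).card := by
      rw [Finset.card_eq_sum_card_fiberwise (f := Prod.snd) (t := univ.filter R)]
      · apply Finset.sum_congr rfl
        intro b hb
        rw [mem_filter] at hb
        symm
        apply Finset.card_bij (fun a _ => (a, b))
        · intro a ha
          simp at ha ⊢
          exact ⟨hb.2, ha⟩
        · intro a _ a' _ h
          simpa using h
        · rintro ⟨a, b'⟩ hx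
          simp at hx
          obtain ⟨⟨h1, h2⟩, rfl⟩ := hx
          exact ⟨a, by simpa using h2, rfl⟩
      · intro x hx
        simp at hx ⊢
        exact hx.1
    exact_mod_cast this
  rw [up_eq, up_eq, key, Fintype.card_prod]
  push_cast
  rw [mul_comm (Fintype.card α : ℝ), ← div_div, div_right_comm, Finset.sum_div, div_mul_eq_mul_div]
  gcongr
  calc _ ≤ ∑ b ∈ univ.filter R, c := by
        apply Finset.sum_le_sum
        intro b hb
        have := h b (mem_filter.1 hb).2
        rwa [up_eq] at this
    _ = _ := by simp

/-- uniform fibres -/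
def UF {β α : Type*} [Fintype β] (f : β → α) : Prop :=
  ∃ N : ℕ, 0 < N ∧ ∀ a, (univ.filter (fun b => f b = a)).card = N

lemma UF.up {β α : Type*} [Fintype β] [Fintype α] {f : β → α} (h : UF f) (P : α → Prop) :
    unifProb P = unifProb (fun b => P (f b)) := by
  obtain ⟨N, hN, h⟩ := h
  have h1 : (univ.filter (fun b => P (f b))).card = (univ.filter P).card * N := by
    rw [Finset.card_eq_sum_card_fiberwise (f := f) (t := univ.filter P)]
    · rw [← smul_eq_mul, ← Finset.sum_const]
      apply Finset.sum_congr rfl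
      intro a ha
      rw [← h a, filter_filter]
      congr 1
      ext b
      simp at ha ⊢
      rintro rfl; exact ha
    · intro x hx
      simpa using hx
  have h2 : Fintype.card β = Fintype.card α * N := by
    rw [← Finset.card_univ, ← Finset.card_univ,
      Finset.card_eq_sum_card_fiberwise (f := f) (t := univ) (fun _ _ => by simp)]
    simp [h]
  rw [up_eq, up_eq, h1, h2]
  push_cast
  rw [mul_div_mul_right]
  exact_mod_cast hN.ne'

lemma UF.pi {β α ι : Type*} [Fintype β] [Fintype ι] [DecidableEq ι] {f : β → α} (h : UF f) :
    UF (fun (b : ι → β) i => f (b i)) := by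
  obtain ⟨N, hN, h⟩ := h
  refine ⟨N ^ Fintype.card ι, by positivity, fun a => ?_⟩
  trans (Fintype.piFinset (fun i => univ.filter (fun b => f b = a i))).card
  · congr 1
    ext A; simp [Fintype.mem_piFinset, funext_iff]
  · rw [Fintype.card_piFinset]
    simp [h]

lemma UF.comp_equiv {β γ α : Type*} [Fintype β] [Fintype γ] {f : β → α} (h : UF f)
    (e : γ ≃ β) : UF (fun c => f (e c)) := by
  obtain ⟨N, hN, h⟩ := h
  refine ⟨N, hN, fun a => ?_⟩
  rw [← h a]
  apply Finset.card_equiv e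
  simp

end basics

section twosat

/-- negation of a literal -/
def ng {n : ℕ} (a : Lit n) : Lit n := (a.1, !a.2)

@[simp] lemma ng_ng {n : ℕ} (a : Lit n) : ng (ng a) = a := by simp [ng]
@[simp] lemma ng_fst {n : ℕ} (a : Lit n) : (ng a).1 = a.1 := rfl
lemma ng_ne {n : ℕ} (a : Lit n) : ng a ≠ a := by
  intro h
  have := congrArg Prod.snd h
  simp [ng] at this
lemma ng_eq_iff {n : ℕ} {a b : Lit n} : ng a = b ↔ a = ng b := by
  constructor
  · rintro rfl; simp
  · rintro rfl; simp

/-- clause `c` yields implication `a → b` -/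
def Mt {n : ℕ} (a b : Lit n) (c : Lit n × Lit n) : Prop := c = (ng a, b) ∨ c = (b, ng a)

lemma Mt_skew {n : ℕ} {a b : Lit n} {c : Lit n × Lit n} (h : Mt a b c) : Mt (ng b) (ng a) c := by
  unfold Mt at *
  simp only [ng_ng]
  tauto

lemma twosat_scc {n m : ℕ} (c : Fin m → Lit n × Lit n)
    (hun : ¬ ∃ σ : Fin n → Bool, ∀ i, σ (c i).1.1 = (c i).1.2 ∨ σ (c i).2.1 = (c i).2.2) :
    ∃ x : Lit n, Relation.ReflTransGen (fun a b => ∃ i, Mt a b (c i)) x (ng x) ∧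
      Relation.ReflTransGen (fun a b => ∃ i, Mt a b (c i)) (ng x) x := by
  classical
  set E : Lit n → Lit n → Prop := fun a b => ∃ i, Mt a b (c i) with hE
  have skew : ∀ a b, E a b → E (ng b) (ng a) := by
    rintro a b ⟨i, hi⟩
    exact ⟨i, Mt_skew hi⟩
  have skewR : ∀ a b, Relation.ReflTransGen E a b → Relation.ReflTransGen E (ng b) (ng a) := by
    intro a b h
    induction h with
    | refl => exact .refl
    | tail _ hbc ih => exact .head (skew _ _ hbc) ih
  by_contra hno
  push Not at hno
  apply hun
  let good : Set (Lit n) → Prop := fun S => (∀ a ∈ S, ∀ b, E a b → b ∈ S) ∧ ∀ a ∈ S, ng a ∉ S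
  have hfin : {S | good S}.Finite := Set.toFinite _
  obtain ⟨S, hS⟩ := hfin.exists_maximal ⟨∅, by simp [good]⟩
  obtain ⟨hcl, hcon⟩ : good S := hS.prop
  have closR : ∀ a b, a ∈ S → Relation.ReflTransGen E a b → b ∈ S := by
    intro a b ha h
    induction h with
    | refl => exact ha
    | tail _ hbc ih => exact hcl _ ih _ hbc
  have ext : ∀ x, x ∉ S → ng x ∉ S → Relation.ReflTransGen E x (ng x) := by
    intro x hx hnx
    by_contra hxx
    have hg : good (S ∪ {b | Relation.ReflTransGen E x b}) := by
      refine ⟨?_, ?_⟩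
      · rintro a (ha | ha) b hab
        · exact Or.inl (hcl a ha b hab)
        · exact Or.inr (Relation.ReflTransGen.tail ha hab)
      · rintro a (ha | ha) (hb | hb)
        · exact hcon a ha hb
        · have := skewR _ _ hb
          rw [ng_ng] at this
          exact hnx (closR _ _ ha this)
        · exact hnx (closR _ _ hb (skewR _ _ ha))
        · have := skewR _ _ hb
          rw [ng_ng] at this
          exact hxx (Relation.ReflTransGen.trans ha this)
    have := hS.le_of_ge hg (Set.subset_union_left)
    exact hx (this (Or.inr .refl))
  have full : ∀ x, x ∈ S ∨ ng x ∈ S := by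
    intro x
    by_contra h
    push Not at h
    have h1 := ext x h.1 h.2
    have h2 := ext (ng x) h.2 (by simpa using h.1)
    rw [ng_ng] at h2
    exact hno x h1 h2
  have hσ : ∀ a : Lit n, a ∈ S → decide ((a.1, true) ∈ S) = a.2 := by
    rintro ⟨v, b⟩ ha
    cases b
    · have := hcon _ ha
      simpa [ng] using this
    · simpa using ha
  refine ⟨fun v => decide ((v, true) ∈ S), fun i => ?_⟩
  by_cases h : (c i).1 ∈ S
  · exact Or.inl (hσ _ h)
  · right
    have h1 := (full (c i).1).resolve_left h
    exact hσ _ (hcl _ h1 _ ⟨i, by left; simp⟩)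

end twosat

section bicycle

lemma exists_walk {α : Type*} {E : α → α → Prop} {a b : α} (h : Relation.ReflTransGen E a b) :
    ∃ (t : ℕ) (z : ℕ → α), z 0 = a ∧ z t = b ∧ ∀ i < t, E (z i) (z (i + 1)) := by
  induction h using Relation.ReflTransGen.head_induction_on with
  | refl => exact ⟨0, fun _ => b, rfl, rfl, by simp⟩
  | @head a c hac _ ih =>
    obtain ⟨t, z, h0, ht, hz⟩ := ih
    refine ⟨t + 1, fun i => Nat.casesOn i a z, rfl, ht, ?_⟩
    intro i hi
    cases i with
    | zero => simpa [h0] using hac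
    | succ i => exact hz i (by omega)

lemma walk_rtg {α : Type*} {E : α → α → Prop} {z : ℕ → α} {t : ℕ}
    (hz : ∀ i < t, E (z i) (z (i + 1))) {i j : ℕ} (hij : i ≤ j) (hj : j ≤ t) :
    Relation.ReflTransGen E (z i) (z j) := by
  induction j, hij using Nat.le_induction with
  | base => exact .refl
  | succ j hij ih => exact (ih (by omega)).tail (hz j (by omega))

lemma lit_cases {n : ℕ} {a b : Lit n} (h : a.1 = b.1) : a = b ∨ b = ng a := by
  obtain ⟨v, s⟩ := a
  obtain ⟨w, u⟩ := b
  simp only at h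
  subst h
  cases s <;> cases u <;> simp [ng]

lemma bicycle {n : ℕ} (E : Lit n → Lit n → Prop) (x : Lit n)
    (h1 : Relation.ReflTransGen E x (ng x)) (h2 : Relation.ReflTransGen E (ng x) x) :
    ∃ (s : ℕ) (y : Fin (s + 1) → Lit n) (t j : Fin (s + 1)) (β : Bool),
      Function.Injective (fun i => (y i).1) ∧ E (ng (y t)) (y 0) ∧
      (∀ i : Fin s, E (y i.castSucc) (y i.succ)) ∧ E (y (Fin.last s)) ((y j).1, β) := by
  classical
  have hex : ∃ t : ℕ, ∃ (x : Lit n) (z : ℕ → Lit n), z 0 = x ∧ z t = ng x ∧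
      (∀ i < t, E (z i) (z (i + 1))) ∧ Relation.ReflTransGen E (ng x) x := by
    obtain ⟨t, z, h0, ht, hz⟩ := exists_walk h1
    exact ⟨t, x, z, h0, ht, hz, h2⟩
  obtain ⟨x, z, hz0, hzt, hz, hx⟩ := Nat.find_spec hex
  have hmin := fun k (hk : k < Nat.find hex) => Nat.find_min hex hk
  generalize Nat.find hex = t at *
  have dist : ∀ i j, i < j → j ≤ t → (z i).1 = (z j).1 → i = 0 ∧ j = t := by
    intro i j hij hjt hv
    rcases lit_cases hv with h | h
    · exfalso
      apply hmin (t - (j - i)) (by omega)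
      refine ⟨x, fun p => if p ≤ i then z p else z (p + (j - i)), by simpa using hz0, ?_, ?_, hx⟩
      · simp only
        split_ifs with hc
        · have : j = t := by omega
          subst this
          have : j - (j - i) = i := by omega
          rw [this, h, hzt]
        · rw [← hzt]; congr 1; omega
      · intro p hp
        simp only
        split_ifs with ha hb hb
        · exact hz p (by omega)
        · have : p = i := by omega
          subst this
          rw [h]
          have : p + 1 + (j - p) = j + 1 := by omega
          rw [this]
          exact hz j (by omega)
        · omega
        · have : p + 1 + (j - i) = p + (j - i) + 1 := by omega
          rw [this]
          exact hz _ (by omega)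
    · by_contra hcon
      apply hmin (j - i) (by omega)
      refine ⟨z i, fun p => z (i + p), rfl, ?_, ?_, ?_⟩
      · simp only
        rw [← h]; congr 1; omega
      · intro p hp
        exact hz (i + p) (by omega)
      · rw [← h]
        have a1 := walk_rtg hz hjt le_rfl
        have a2 := walk_rtg hz (Nat.zero_le i) (by omega)
        rw [hzt] at a1
        rw [hz0] at a2
        exact (a1.trans hx).trans a2
  have ht1 : 1 ≤ t := by
    rcases Nat.eq_zero_or_pos t with h | h
    · subst h
      rw [hz0] at hzt
      exact absurd hzt.symm (ng_ne x)
    · exact h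
  obtain ⟨N, z2, h20, h2N, hz2⟩ := exists_walk hx
  have hN1 : 1 ≤ N := by
    rcases Nat.eq_zero_or_pos N with h | h
    · subst h
      rw [h20] at h2N
      exact absurd h2N (ng_ne x)
    · exact h
  obtain ⟨Z, hZ⟩ : ∃ Z : ℕ → Lit n, Z = fun p => if p ≤ t then z p else z2 (p - t) := ⟨_, rfl⟩
  have hZ1 : ∀ p ≤ t, Z p = z p := by
    intro p hp; rw [hZ]; simp [hp]
  have hZ2 : ∀ p, t ≤ p → Z p = z2 (p - t) := by
    intro p hp
    rcases hp.eq_or_lt with h | h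
    · subst h
      rw [hZ1 _ le_rfl, hzt, ← h20]; simp
    · rw [hZ]; simp [h.not_ge]
  have hZw : ∀ p < t + N, E (Z p) (Z (p + 1)) := by
    intro p hp
    by_cases hpt : p < t
    · rw [hZ1 p (by omega), hZ1 (p+1) (by omega)]
      exact hz p hpt
    · rw [hZ2 p (by omega), hZ2 (p+1) (by omega)]
      have : p + 1 - t = p - t + 1 := by omega
      rw [this]
      exact hz2 _ (by omega)
  have hZ0 : Z 0 = x := by rw [hZ1 0 (by omega), hz0]
  have hZt : Z t = ng x := by rw [hZ1 t le_rfl, hzt]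
  have hex2 : ∃ r, t < r ∧ ∃ q < r, (Z q).1 = (Z r).1 := by
    refine ⟨t + N, by omega, 0, by omega, ?_⟩
    rw [hZ0, hZ2 _ (by omega)]
    simp [h2N]
  obtain ⟨htr, q, hqr, hq⟩ := Nat.find_spec hex2
  have hrN : Nat.find hex2 ≤ t + N := by
    apply Nat.find_min'
    refine ⟨by omega, 0, by omega, ?_⟩
    rw [hZ0, hZ2 _ (by omega)]
    simp [h2N]
  have hrmin := fun k (hk : k < Nat.find hex2) => Nat.find_min hex2 hk
  generalize Nat.find hex2 = r at *
  have dist2 : ∀ i j, i < j → j < r → (Z i).1 = (Z j).1 → i = 0 ∧ j = t := by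
    intro i j hij hjr hv
    by_cases hjt : j ≤ t
    · rw [hZ1 i (by omega), hZ1 j hjt] at hv
      exact dist i j hij hjt hv
    · exact absurd ⟨by omega, i, hij, hv⟩ (hrmin j hjr)
  obtain ⟨q, hq1, hqr, hq⟩ : ∃ q, 1 ≤ q ∧ q < r ∧ (Z q).1 = (Z r).1 := by
    rcases Nat.eq_zero_or_pos q with h | h
    · subst h
      refine ⟨t, ht1, htr, ?_⟩
      rw [← hq, hZt, hZ0, ng_fst]
    · exact ⟨q, h, hqr, hq⟩
  obtain ⟨s, rfl⟩ : ∃ s, r = s + 2 := ⟨r - 2, by omega⟩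
  refine ⟨s, fun i => Z (i.1 + 1), ⟨t - 1, by omega⟩, ⟨q - 1, by omega⟩, (Z (s + 2)).2,
    ?_, ?_, ?_, ?_⟩
  · intro i j hij
    simp only at hij
    ext
    rcases lt_trichotomy i.1 j.1 with h | h | h
    · have := dist2 _ _ (by omega) (by omega) hij
      omega
    · exact h
    · have := dist2 _ _ (by omega) (by omega) hij.symm
      omega
  · simp only [Nat.sub_add_cancel ht1, hZt, ng_ng]
    have := hZw 0 (by omega)
    rw [hZ0] at this
    simpa using this
  · intro i
    have := hZw (i.1 + 1) (by omega)
    simpa using this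
  · have := hZw (s + 1) (by omega)
    simp only [Nat.sub_add_cancel hq1, hq, Fin.val_last]
    exact this

/-- index type of bicycle clauses -/
abbrev BI (s : ℕ) := Option (Option (Fin s))

/-- implications of the bicycle -/
def bic {n s : ℕ} (y : Fin (s + 1) → Lit n) (t : Fin (s + 1)) (v : Lit n) :
    BI s → Lit n × Lit n
  | none => (ng (y t), y 0)
  | some none => (y (Fin.last s), v)
  | some (some i) => (y i.castSucc, y i.succ)

lemma bic_inj {n s m : ℕ} (c : Fin m → Lit n × Lit n) (y : Fin (s + 1) → Lit n)
    (hy : Function.Injective (fun i => (y i).1)) (t : Fin (s + 1)) (v : Lit n)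
    (f : BI s → Fin m) (hf : ∀ u, Mt (bic y t v u).1 (bic y t v u).2 (c (f u))) :
    Function.Injective f := by
  have hne : ∀ a b, ng (y a) ≠ y b := by
    intro a b h
    have : a = b := hy (by simpa using congrArg Prod.fst h)
    subst this
    exact ng_ne _ h
  have hne' : ∀ a b, y b ≠ ng (y a) := fun a b h => hne a b h.symm
  have hyy : ∀ a b, y a = y b → a = b := fun a b h => hy (by simp [h])
  have hnn : ∀ a b, ng (y a) = ng (y b) → a = b := fun a b h => by
    apply hyy; rw [ng_eq_iff] at h; simpa using h
  have key : ∀ (C : Lit n × Lit n) (a b a' b' : Lit n), Mt a b C → Mt a' b' C →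
      (ng a = ng a' ∧ b = b') ∨ (ng a = b' ∧ b = ng a') := by
    rintro C a b a' b' (h | h) (h' | h') <;> rw [h] at h' <;> simp only [Prod.mk.injEq] at h' <;>
      tauto
  intro u w huw
  have hu := hf u
  have hw := hf w
  rw [← huw] at hw
  have := key _ _ _ _ _ hu hw
  rcases u with _ | _ | i <;> rcases w with _ | _ | j <;> simp only [bic, ng_ng] at this
  · rfl
  · exfalso
    rcases this with ⟨h, _⟩ | ⟨_, h⟩ <;> exact hne' _ _ h
  · exfalso
    rcases this with ⟨h, _⟩ | ⟨_, h⟩ <;> exact hne' _ _ h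
  · exfalso
    rcases this with ⟨h, _⟩ | ⟨h, _⟩ <;> exact hne _ _ h
  · rfl
  · exfalso
    rcases this with ⟨h, _⟩ | ⟨h, _⟩
    · exact absurd (hnn _ _ h).symm (Fin.castSucc_ne_last j)
    · exact hne _ _ h
  · exfalso
    rcases this with ⟨h, _⟩ | ⟨h, _⟩ <;> exact hne _ _ h
  · exfalso
    rcases this with ⟨h, _⟩ | ⟨_, h⟩
    · exact absurd (hnn _ _ h) (Fin.castSucc_ne_last i)
    · exact hne' _ _ h
  · rcases this with ⟨h, _⟩ | ⟨h, _⟩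
    · have := hnn _ _ h
      rw [Fin.castSucc_inj] at this
      rw [this]
    · exact absurd h (hne _ _)

lemma unsat_bic {n m : ℕ} (c : Fin m → Lit n × Lit n)
    (hun : ¬ ∃ σ : Fin n → Bool, ∀ i, σ (c i).1.1 = (c i).1.2 ∨ σ (c i).2.1 = (c i).2.2) :
    ∃ (s : Fin n) (p : (Fin (s.1 + 1) → Lit n) × (Fin (s.1 + 1) × Fin (s.1 + 1) × Bool)
        × (BI s.1 ↪ Fin m)),
      ∀ u, Mt (bic p.1 p.2.1.1 ((p.1 p.2.1.2.1).1, p.2.1.2.2) u).1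
        (bic p.1 p.2.1.1 ((p.1 p.2.1.2.1).1, p.2.1.2.2) u).2 (c (p.2.2 u)) := by
  obtain ⟨x, h1, h2⟩ := twosat_scc c hun
  obtain ⟨s, y, t, j, β, hy, ha, hb, hc⟩ := bicycle _ x h1 h2
  have hs : s < n := by
    have := Fintype.card_le_of_injective _ hy
    simp at this
    omega
  have : ∀ u : BI s, ∃ i, Mt (bic y t ((y j).1, β) u).1 (bic y t ((y j).1, β) u).2 (c i) := by
    rintro (_ | _ | i)
    · exact ha
    · exact hc
    · exact hb i
  choose f hf using this
  exact ⟨⟨s, hs⟩, (y, (t, j, β), ⟨f, bic_inj c y hy t _ f hf⟩), hf⟩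

end bicycle

section moment

lemma trans_sum (μ : Bool → Bool → ℝ) (κ : Bool → ℝ) (lam : ℝ) (n : ℕ)
    (hκ : ∀ b, κ true * μ true b + κ false * μ false b = lam * κ b) (s : ℕ) :
    ∑ y : Fin (s + 1) → Lit n, κ (y 0).2 * ∏ i : Fin s, μ (y i.castSucc).2 (y i.succ).2
      = (n * lam) ^ s * (n * (κ true + κ false)) := by
  induction s with
  | zero =>
    rw [← (Equiv.funUnique (Fin 1) (Lit n)).symm.sum_comp]
    simp [Fintype.sum_prod_type]
    ring
  | succ s ih =>
    rw [← (Fin.consEquiv (fun _ : Fin (s + 2) => Lit n)).sum_comp, Fintype.sum_prod_type,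
      Finset.sum_comm]
    have : ∀ y : Fin (s + 1) → Lit n,
        ∑ x : Lit n, κ ((Fin.consEquiv (fun _ : Fin (s + 2) => Lit n)) (x, y) 0).2 *
          ∏ i : Fin (s + 1), μ ((Fin.consEquiv (fun _ : Fin (s + 2) => Lit n)) (x, y) i.castSucc).2
            ((Fin.consEquiv (fun _ : Fin (s + 2) => Lit n)) (x, y) i.succ).2
        = (n * lam) * (κ (y 0).2 * ∏ i : Fin s, μ (y i.castSucc).2 (y i.succ).2) := by
      intro y
      have e : ∀ x : Lit n, κ ((Fin.consEquiv (fun _ : Fin (s + 2) => Lit n)) (x, y) 0).2 *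
          ∏ i : Fin (s + 1), μ ((Fin.consEquiv (fun _ : Fin (s + 2) => Lit n)) (x, y) i.castSucc).2
            ((Fin.consEquiv (fun _ : Fin (s + 2) => Lit n)) (x, y) i.succ).2
          = (κ x.2 * μ x.2 (y 0).2) * ∏ i : Fin s, μ (y i.castSucc).2 (y i.succ).2 := by
        intro x
        rw [Fin.prod_univ_succ]
        simp [Fin.consEquiv, mul_assoc]
      simp_rw [e]
      rw [← Finset.sum_mul, Fintype.sum_prod_type]
      simp only [Fintype.sum_bool, hκ, Finset.sum_const, Finset.card_univ, Fintype.card_fin,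
        nsmul_eq_mul]
      ring
    rw [Finset.sum_congr rfl (fun y _ => this y), ← Finset.mul_sum, ih]
    ring

lemma first_moment {X : Type*} [Fintype X] [Nonempty X] (n m : ℕ) (hn : 2 ≤ n)
    (cl : X → Lit n × Lit n) (Q : Bool → Bool → ℝ) (hQ0 : ∀ a b, 0 ≤ Q a b)
    (hQ1 : ∀ a b, Q a b ≤ 1)
    (hcl : ∀ a b, unifProb (fun x => cl x = (a, b)) ≤ Q a.2 b.2 / (n * (n - 1)))
    (κ : Bool → ℝ) (κ0 : ℝ) (hκ0 : 0 < κ0) (hκκ : ∀ b, κ0 ≤ κ b) (lam : ℝ)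
    (hκ : ∀ b, κ true * (Q false b + Q b false) + κ false * (Q true b + Q b true) = lam * κ b)
    (hlam : 0 < lam) (c : ℝ) (hc : 0 ≤ c) (hm : (m : ℝ) ≤ c * (n - 1)) :
    unifProb (fun A : Fin m → X => ¬ ∃ σ : Fin n → Bool, ∀ i,
        σ (cl (A i)).1.1 = (cl (A i)).1.2 ∨ σ (cl (A i)).2.1 = (cl (A i)).2.2)
      ≤ (∑ s ∈ range n, (s + 1 : ℝ) ^ 2 * (c * lam) ^ s)
        * (8 * c ^ 2 * ((κ true + κ false) / κ0)) / n := by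
  classical
  have hn0 : (0 : ℝ) < n := by positivity
  have hn1 : (0 : ℝ) < n - 1 := by
    have : (2 : ℝ) ≤ n := by exact_mod_cast hn
    linarith
  set D : ℝ := n * (n - 1) with hD
  have hD0 : 0 < D := by positivity
  let μ : Bool → Bool → ℝ := fun a b => Q (!a) b + Q b (!a)
  have hμ0 : ∀ a b, 0 ≤ μ a b := fun a b => add_nonneg (hQ0 _ _) (hQ0 _ _)
  have hμ2 : ∀ a b, μ a b ≤ 2 := fun a b => by
    have := hQ1 (!a) b
    have := hQ1 b (!a)
    simp only [μ]; linarith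
  have hM : ∀ a b : Lit n, unifProb (fun x => Mt a b (cl x)) ≤ μ a.2 b.2 / D := by
    intro a b
    refine (up_or _ _).trans ?_
    have h1 := hcl (ng a) b
    have h2 := hcl b (ng a)
    simp only [μ, add_div]
    exact add_le_add h1 h2
  have step1 : unifProb (fun A : Fin m → X => ¬ ∃ σ : Fin n → Bool, ∀ i,
        σ (cl (A i)).1.1 = (cl (A i)).1.2 ∨ σ (cl (A i)).2.1 = (cl (A i)).2.2)
      ≤ ∑ s : Fin n, ∑ p : (Fin (s.1 + 1) → Lit n) × (Fin (s.1 + 1) × Fin (s.1 + 1) × Bool)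
        × (BI s.1 ↪ Fin m), unifProb (fun A : Fin m → X =>
        ∀ u, Mt (bic p.1 p.2.1.1 ((p.1 p.2.1.2.1).1, p.2.1.2.2) u).1
        (bic p.1 p.2.1.1 ((p.1 p.2.1.2.1).1, p.2.1.2.2) u).2 (cl (A (p.2.2 u)))) := by
    refine (up_mono (fun A hA => unsat_bic (fun i => cl (A i)) hA)).trans ?_
    refine (up_union _).trans ?_
    apply Finset.sum_le_sum
    intro s _
    exact up_union _
  refine step1.trans ?_
  rw [Finset.sum_mul, Finset.sum_div, ← Fin.sum_univ_eq_sum_range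
    (fun s => ((s : ℝ) + 1) ^ 2 * (c * lam) ^ s * (8 * c ^ 2 * ((κ true + κ false) / κ0)) / n)]
  apply Finset.sum_le_sum
  intro s _
  obtain ⟨s, hs⟩ := s
  simp only
  have step2 : ∀ p : (Fin (s + 1) → Lit n) × (Fin (s + 1) × Fin (s + 1) × Bool)
        × (BI s ↪ Fin m), unifProb (fun A : Fin m → X =>
        ∀ u, Mt (bic p.1 p.2.1.1 ((p.1 p.2.1.2.1).1, p.2.1.2.2) u).1
        (bic p.1 p.2.1.1 ((p.1 p.2.1.2.1).1, p.2.1.2.2) u).2 (cl (A (p.2.2 u))))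
      ≤ (∏ i : Fin s, μ (p.1 i.castSucc).2 (p.1 i.succ).2) * (4 * (1 / D) ^ (s + 2)) := by
    rintro ⟨y, ⟨t, j, β⟩, f⟩
    simp only
    rw [up_pi_inj f f.injective (fun u x => Mt (bic y t ((y j).1, β) u).1
      (bic y t ((y j).1, β) u).2 (cl x))]
    rw [Fintype.prod_option, Fintype.prod_option]
    have e : (∏ i : Fin s, μ (y i.castSucc).2 (y i.succ).2) * (4 * (1 / D) ^ (s + 2))
        = (2 / D) * ((2 / D) * ∏ i : Fin s, (μ (y i.castSucc).2 (y i.succ).2 / D)) := by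
      rw [Finset.prod_div_distrib]
      simp only [Finset.prod_const, Finset.card_univ, Fintype.card_fin]
      rw [one_div, inv_pow, pow_add]
      field_simp
      norm_num
    rw [e]
    have h2 : ∀ a b : Lit n, unifProb (fun x => Mt a b (cl x)) ≤ 2 / D := fun a b =>
      (hM a b).trans (by gcongr; exact hμ2 _ _)
    refine mul_le_mul (h2 _ _) (mul_le_mul (h2 _ _) ?_ ?_ ?_) ?_ ?_
    · apply Finset.prod_le_prod
      · intro i _; exact up_nonneg _
      · intro i _; exact hM _ _
    · exact Finset.prod_nonneg (fun i _ => up_nonneg _)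
    · positivity
    · exact mul_nonneg (up_nonneg _) (Finset.prod_nonneg (fun i _ => up_nonneg _))
    · positivity
  refine (Finset.sum_le_sum (fun p _ => step2 p)).trans ?_
  rw [Fintype.sum_prod_type]
  simp only [Finset.sum_const, Finset.card_univ, nsmul_eq_mul]
  rw [← Finset.mul_sum, ← Finset.sum_mul]
  have hG : ∑ y : Fin (s + 1) → Lit n, ∏ i : Fin s, μ (y i.castSucc).2 (y i.succ).2
      ≤ (n * lam) ^ s * (n * (κ true + κ false)) / κ0 := by
    rw [le_div_iff₀ hκ0, ← trans_sum μ κ lam n (by simpa [μ] using hκ) s, Finset.sum_mul]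
    apply Finset.sum_le_sum
    intro y _
    rw [mul_comm]
    exact mul_le_mul_of_nonneg_right (hκκ _) (Finset.prod_nonneg (fun i _ => hμ0 _ _))
  have hcard : (Fintype.card ((Fin (s + 1) × Fin (s + 1) × Bool) × (BI s ↪ Fin m)) : ℝ)
      ≤ 2 * (s + 1) ^ 2 * (c * (n - 1)) ^ (s + 2) := by
    rw [Fintype.card_prod]
    have h1 : (Fintype.card (BI s ↪ Fin m) : ℝ) ≤ (m : ℝ) ^ (s + 2) := by
      rw [Fintype.card_embedding_eq]
      have := Nat.descFactorial_le_pow (Fintype.card (Fin m)) (Fintype.card (BI s))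
      simp only [Fintype.card_fin, Fintype.card_option] at this ⊢
      exact_mod_cast this
    have h2 : (m : ℝ) ^ (s + 2) ≤ (c * (n - 1)) ^ (s + 2) := by gcongr
    have h3 : (Fintype.card (Fin (s + 1) × Fin (s + 1) × Bool) : ℝ) = 2 * (s + 1) ^ 2 := by
      simp only [Fintype.card_prod, Fintype.card_fin, Fintype.card_bool]
      push_cast; ring
    push_cast
    rw [h3]
    have := h1.trans h2
    gcongr
  have hκs : 0 < κ true + κ false := by
    have := hκκ true
    have := hκκ false
    linarith
  calc _ ≤ (2 * (s + 1) ^ 2 * (c * (n - 1)) ^ (s + 2)) *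
        (((n * lam) ^ s * (n * (κ true + κ false)) / κ0) * (4 * (1 / D) ^ (s + 2))) := by
        gcongr
        exact mul_nonneg (Finset.sum_nonneg fun y _ => Finset.prod_nonneg (fun i _ => hμ0 _ _))
          (by positivity)
    _ = _ := by
        rw [hD]
        simp only [mul_pow, div_pow, one_pow]
        field_simp
        ring

end moment

section ordered
open Classical

/-- ordered clause to clause -/
def toCl {n k : ℕ} (x : (Fin k ↪ Fin n) × (Fin k → Bool)) : Clause n k :=
  ⟨univ.image (fun j => (x.1 j, x.2 j)), by
    rw [Finset.card_image_of_injective]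
    · simp
    · intro a b h
      exact x.1.injective (congrArg Prod.fst h), by
    rw [Finset.image_image, Finset.card_image_of_injective]
    · simp
    · intro a b h
      exact x.1.injective h⟩

/-- number of positive signs -/
def cnt {k : ℕ} (s : Fin k → Bool) : ℕ := (univ.filter fun j => s j = true).card

lemma posCount_toCl {n k : ℕ} (x : (Fin k ↪ Fin n) × (Fin k → Bool)) :
    (toCl x).posCount = cnt x.2 := by
  unfold Clause.posCount cnt toCl
  symm
  apply Finset.card_bij (fun j _ => (x.1 j, x.2 j))
  · intro j hj
    simp at hj ⊢
    exact hj
  · intro a _ b _ h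
    exact x.1.injective (congrArg Prod.fst h)
  · rintro ⟨v, b⟩ h
    simp at h
    obtain ⟨⟨j, rfl, rfl⟩, h⟩ := h
    exact ⟨j, by simpa using h, rfl⟩

lemma uf_toCl {n k : ℕ} : UF (toCl (n := n) (k := k)) := by
  refine ⟨k.factorial, Nat.factorial_pos k, fun C => ?_⟩
  have hc : Fintype.card C.1 = k := by simpa using C.2.1
  have e0 : Fin k ≃ C.1 := (Fintype.equivFinOfCardEq hc).symm
  have hcard : Fintype.card (Fin k ≃ C.1) = k.factorial := by
    rw [Fintype.card_equiv e0]; simp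
  have hinj : ∀ a ∈ C.1, ∀ b ∈ C.1, a.1 = b.1 → a = b := by
    have : Set.InjOn Prod.fst (C.1 : Set (Lit n)) := by
      rw [← Finset.card_image_iff, C.2.1, C.2.2]
    intro a ha b hb h
    exact this ha hb h
  rw [← hcard, ← Finset.card_univ]
  symm
  apply Finset.card_bij (fun (g : Fin k ≃ C.1) _ =>
    ((⟨fun j => (g j).1.1, fun a b h => g.injective (Subtype.ext
      (hinj _ (g a).2 _ (g b).2 h))⟩ : Fin k ↪ Fin n), fun j => (g j).1.2))
  · intro g _
    simp only [mem_filter, mem_univ, true_and]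
    apply Subtype.ext
    ext a
    simp only [toCl, mem_image, mem_univ, true_and]
    constructor
    · rintro ⟨j, rfl⟩
      exact (g j).2
    · intro ha
      refine ⟨g.symm ⟨a, ha⟩, ?_⟩
      change ((g (g.symm ⟨a, ha⟩)).1.1, (g (g.symm ⟨a, ha⟩)).1.2) = a
      simp
  · intro g _ g' _ h
    ext j
    · have := congrArg (fun x => x.1 j) h
      change (g j).1.1 = (g' j).1.1 at this
      rw [this]
    · have := congrArg (fun x => x.2 j) h
      change (g j).1.2 = (g' j).1.2 at this
      rw [this]
  · rintro ⟨e, s⟩ h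
    simp only [mem_filter, mem_univ, true_and] at h
    have hC : univ.image (fun j => (e j, s j)) = C.1 := congrArg Subtype.val h
    have hmem : ∀ j, (e j, s j) ∈ C.1 := fun j => by
      rw [← hC]; exact mem_image_of_mem _ (mem_univ j)
    have hb : Function.Bijective (fun j => (⟨(e j, s j), hmem j⟩ : C.1)) := by
      constructor
      · intro a b h
        have := congrArg (fun x => x.1.1) h
        exact e.injective this
      · rintro ⟨a, ha⟩
        rw [← hC] at ha
        obtain ⟨j, _, hj⟩ := mem_image.1 ha
        exact ⟨j, Subtype.ext hj⟩
    refine ⟨Equiv.ofBijective _ hb, mem_univ _, ?_⟩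
    ext j <;> simp

/-- selected index -/
def selI {k l : ℕ} (hl : 0 < l) (S : Fin l → Fin k → Bool) : Fin l :=
  match (List.finRange l).find? (fun i => decide (i.1 + 1 < l ∧ 2 ≤ cnt (S i))) with
  | some i => i
  | none => ⟨l - 1, Nat.sub_lt hl one_pos⟩

lemma select_eq {n k l : ℕ} (hl : 0 < l) (e : Fin l → (Fin k ↪ Fin n)) (S : Fin l → Fin k → Bool) :
    select hl (fun t => toCl (e t, S t)) = toCl (e (selI hl S), S (selI hl S)) := by
  unfold select selI
  simp only [posCount_toCl]
  split <;> rfl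

lemma selI_le {k l : ℕ} (hl : 0 < l) (S : Fin l → Fin k → Bool) (h : cnt (S (selI hl S)) ≤ 1) :
    (selI hl S).1 + 1 = l ∧ ∀ t : Fin l, t.1 + 1 < l → cnt (S t) ≤ 1 := by
  unfold selI at h ⊢
  split at h
  · rename_i i hi
    have := List.find?_some hi
    simp at this
    omega
  · rename_i hi
    refine ⟨Nat.sub_add_cancel hl, ?_⟩
    intro t ht
    rw [List.find?_eq_none] at hi
    have := hi t (List.mem_finRange t)
    simp at this
    have := this ht
    omega

lemma exists_pair {k : ℕ} (hk : 2 ≤ k) (s : Fin k → Bool) : ∃ j : Fin k × Fin k, j.1 ≠ j.2 ∧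
    (2 ≤ cnt s → s j.1 = true ∧ s j.2 = true) ∧ (cnt s = 1 → s j.1 = true ∧ s j.2 = false) ∧
    (cnt s = 0 → s j.1 = false ∧ s j.2 = false) := by
  have : Nontrivial (Fin k) := Fin.nontrivial_iff_two_le.2 hk
  rcases lt_trichotomy (cnt s) 1 with h | h | h
  · have h0 : cnt s = 0 := by omega
    obtain ⟨a, b, hab⟩ := exists_pair_ne (Fin k)
    refine ⟨(a, b), hab, by omega, by omega, fun _ => ?_⟩
    unfold cnt at h0
    rw [Finset.card_eq_zero, Finset.filter_eq_empty_iff] at h0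
    exact ⟨by simpa using h0 (mem_univ a), by simpa using h0 (mem_univ b)⟩
  · have h1 := h
    unfold cnt at h1
    rw [Finset.card_eq_one] at h1
    obtain ⟨a, ha⟩ := h1
    obtain ⟨b, hb⟩ := exists_ne a
    refine ⟨(a, b), hb.symm, by omega, fun _ => ?_, by omega⟩
    constructor
    · have : a ∈ univ.filter (fun j => s j = true) := by rw [ha]; simp
      simpa using this
    · have : b ∉ univ.filter (fun j => s j = true) := by rw [ha]; simpa using hb
      simpa using this
  · have h1 := h
    unfold cnt at h1
    rw [Finset.one_lt_card] at h1
    obtain ⟨a, ha, b, hb, hab⟩ := h1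
    refine ⟨(a, b), hab, fun _ => ?_, by omega, by omega⟩
    simpa using And.intro ha hb

lemma cnt_card (k c : ℕ) :
    (univ.filter (fun s : Fin k → Bool => cnt s = c)).card = k.choose c := by
  have h := Finset.card_powersetCard c (univ : Finset (Fin k))
  rw [Finset.card_univ, Fintype.card_fin] at h
  rw [← h]
  refine Finset.card_bij' (fun s _ => univ.filter fun j => s j = true)
    (fun T _ => fun j => decide (j ∈ T)) ?_ ?_ ?_ ?_
  · intro s hs
    simp only [mem_filter, mem_univ, true_and] at hs
    rw [mem_powersetCard]
    exact ⟨subset_univ _, hs⟩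
  · intro T hT
    rw [mem_powersetCard] at hT
    rw [mem_filter]
    exact ⟨mem_univ _, by simp [cnt, hT.2]⟩
  · intro s _
    funext j
    simp
  · intro T _
    ext j
    simp

lemma up_cnt (k c : ℕ) : unifProb (fun s : Fin k → Bool => cnt s = c) = k.choose c / 2 ^ k := by
  rw [up_eq, cnt_card]
  simp

lemma up_cnt_le (k : ℕ) : unifProb (fun s : Fin k → Bool => cnt s ≤ 1) = (k + 1) / 2 ^ k := by
  rw [up_eq]
  have : (univ.filter (fun s : Fin k → Bool => cnt s ≤ 1)).card = 1 + k := by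
    have h0 := cnt_card k 0
    have h1 := cnt_card k 1
    simp only [Nat.choose_zero_right, Nat.choose_one_right] at h0 h1
    trans (univ.filter (fun s : Fin k → Bool => cnt s = 0)).card
      + (univ.filter (fun s : Fin k → Bool => cnt s = 1)).card
    swap
    · rw [h0, h1]
    rw [← Finset.card_union_of_disjoint]
    · congr 1
      ext s
      simp
      omega
    · rw [Finset.disjoint_filter]
      intro s _ h
      omega
  rw [this]
  simp [add_comm]

lemma up_sel (k l c : ℕ) (hl : 0 < l) (hc : c ≤ 1) :
    unifProb (fun S : Fin l → Fin k → Bool => cnt (S (selI hl S)) = c)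
      ≤ ((k + 1 : ℝ) / 2 ^ k) ^ (l - 1) * (k.choose c / 2 ^ k) := by
  obtain ⟨l, rfl⟩ : ∃ l', l = l' + 1 := ⟨l - 1, by omega⟩
  calc _ ≤ unifProb (fun S : Fin (l + 1) → Fin k → Bool => ∀ t,
        (fun (t : Fin (l + 1)) s => if t.1 < l then cnt s ≤ 1 else cnt s = c) t (S t)) := by
        apply up_mono
        intro S hS
        have h := selI_le hl S (by omega)
        intro t
        split_ifs with ht
        · exact h.2 t (by omega)
        · have : t = selI hl S := by ext; omega
          rw [this, hS]
    _ = _ := by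
        rw [up_pi_all (fun (t : Fin (l + 1)) (s : Fin k → Bool) =>
          if t.1 < l then cnt s ≤ 1 else cnt s = c), Fin.prod_univ_castSucc]
        simp [up_cnt, up_cnt_le, div_pow]

lemma up_sel2 (k l : ℕ) (hl : 0 < l) :
    unifProb (fun S : Fin l → Fin k → Bool => 2 ≤ cnt (S (selI hl S)))
      ≤ 1 - ((k + 1 : ℝ) / 2 ^ k) ^ l := by
  have h : unifProb (fun S : Fin l → Fin k → Bool => ∀ t, (fun _ s => cnt s ≤ 1) t (S t))
      = ((k + 1 : ℝ) / 2 ^ k) ^ l := by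
    rw [up_pi_all (fun _ s => cnt s ≤ 1)]
    simp [up_cnt_le, div_pow]
  rw [up_compl] at h
  have : unifProb (fun S : Fin l → Fin k → Bool => 2 ≤ cnt (S (selI hl S)))
      ≤ unifProb (fun S : Fin l → Fin k → Bool => ¬ ∀ t, (fun _ s => cnt s ≤ 1) t (S t)) := by
    apply up_mono
    intro S hS hcon
    have := hcon (selI hl S)
    simp only at this
    omega
  linarith

lemma up_emb {n k : ℕ} (hn : 2 ≤ n) (i j : Fin k) (hij : i ≠ j) (x y : Fin n) :
    unifProb (fun e : Fin k ↪ Fin n => e i = x ∧ e j = y) ≤ 1 / (n * (n - 1)) := by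
  have hn1 : (0 : ℝ) < n - 1 := by
    have : (2 : ℝ) ≤ n := by exact_mod_cast hn
    linarith
  have hn0 : (0 : ℝ) < n := by linarith
  by_cases hxy : x = y
  · have : unifProb (fun e : Fin k ↪ Fin n => e i = x ∧ e j = y) = 0 := by
      rw [up_eq, Finset.filter_eq_empty_iff.2]
      · simp
      · rintro e _ ⟨h1, h2⟩
        exact hij (e.injective (by rw [h1, h2, hxy]))
    rw [this]; positivity
  let N : Fin n × Fin n → ℕ := fun p =>
    (univ.filter (fun e : Fin k ↪ Fin n => e i = p.1 ∧ e j = p.2)).card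
  have hN : ∀ p ∈ (univ : Finset (Fin n)).offDiag, N p = N (x, y) := by
    rintro ⟨x', y'⟩ hp
    simp only [mem_offDiag, mem_univ, true_and] at hp
    let π : Equiv.Perm (Fin n) := (Equiv.swap x x').trans (Equiv.swap (Equiv.swap x x' y) y')
    have hπx : π x = x' := by
      simp only [π, Equiv.trans_apply, Equiv.swap_apply_left]
      apply Equiv.swap_apply_of_ne_of_ne
      · intro h
        have : Equiv.swap x x' x = Equiv.swap x x' y := by rw [Equiv.swap_apply_left]; exact h
        exact hxy ((Equiv.swap x x').injective this)
      · exact hp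
    have hπy : π y = y' := by
      simp [π]
    symm
    apply Finset.card_equiv (Equiv.embeddingCongr (Equiv.refl (Fin k)) π)
    intro e
    simp only [mem_filter, mem_univ, true_and]
    change _ ↔ π (e i) = x' ∧ π (e j) = y'
    rw [← hπx, ← hπy, π.injective.eq_iff, π.injective.eq_iff]
  have hsum : Fintype.card (Fin k ↪ Fin n) = (n * n - n) * N (x, y) := by
    rw [← Finset.card_univ, Finset.card_eq_sum_card_fiberwise (f := fun e : Fin k ↪ Fin n =>
      (e i, e j)) (t := (univ : Finset (Fin n)).offDiag)]
    · have : ∀ p ∈ (univ : Finset (Fin n)).offDiag,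
        (univ.filter (fun e : Fin k ↪ Fin n => (e i, e j) = p)).card = N (x, y) := by
        intro p hp
        rw [← hN p hp]
        simp only [N, Prod.ext_iff]
      rw [Finset.sum_congr rfl this]
      simp [offDiag_card]
    · intro e _
      simp [hij]
  have hsub : ((n * n - n : ℕ) : ℝ) = n * (n - 1) := by
    rw [Nat.cast_sub (Nat.le_mul_self n)]; push_cast; ring
  have hsumR : (Fintype.card (Fin k ↪ Fin n) : ℝ) = n * (n - 1) * N (x, y) := by
    rw [hsum, Nat.cast_mul, hsub]
  rw [up_eq, hsumR]
  change (N (x, y) : ℝ) / _ ≤ _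
  rcases Nat.eq_zero_or_pos (N (x, y)) with h | h
  · rw [h]; simp; positivity
  · have : (0 : ℝ) < N (x, y) := by exact_mod_cast h
    apply le_of_eq
    field_simp

end ordered

section final

/-- type probabilities -/
noncomputable def qf (k l : ℕ) : Bool → Bool → ℝ
  | true, true => 1 - ((k + 1 : ℝ) / 2 ^ k) ^ l
  | true, false => ((k + 1 : ℝ) / 2 ^ k) ^ (l - 1) * (k / 2 ^ k)
  | false, true => 0
  | false, false => ((k + 1 : ℝ) / 2 ^ k) ^ (l - 1) * (1 / 2 ^ k)

/-- the ordered two-clause chosen -/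
noncomputable def cl2 {n k l : ℕ} (hk : 2 ≤ k) (hl : 0 < l)
    (x : (Fin l → (Fin k ↪ Fin n)) × (Fin l → Fin k → Bool)) : Lit n × Lit n :=
  ((x.1 (selI hl x.2) (exists_pair hk (x.2 (selI hl x.2))).choose.1,
    x.2 (selI hl x.2) (exists_pair hk (x.2 (selI hl x.2))).choose.1),
   (x.1 (selI hl x.2) (exists_pair hk (x.2 (selI hl x.2))).choose.2,
    x.2 (selI hl x.2) (exists_pair hk (x.2 (selI hl x.2))).choose.2))

lemma up_type {k l : ℕ} (hk : 2 ≤ k) (hl : 0 < l) (a b : Bool) :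
    unifProb (fun S : Fin l → Fin k → Bool =>
      S (selI hl S) (exists_pair hk (S (selI hl S))).choose.1 = a ∧
      S (selI hl S) (exists_pair hk (S (selI hl S))).choose.2 = b) ≤ qf k l a b := by
  have h0 := up_sel k l 0 hl (by omega)
  have h1 := up_sel k l 1 hl (by omega)
  have h2 := up_sel2 k l hl
  have spec : ∀ S : Fin l → Fin k → Bool,
    (S (selI hl S) (exists_pair hk (S (selI hl S))).choose.1 = true ∧
      S (selI hl S) (exists_pair hk (S (selI hl S))).choose.2 = true ∧ 2 ≤ cnt (S (selI hl S))) ∨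
    (S (selI hl S) (exists_pair hk (S (selI hl S))).choose.1 = true ∧
      S (selI hl S) (exists_pair hk (S (selI hl S))).choose.2 = false ∧ cnt (S (selI hl S)) = 1) ∨
    (S (selI hl S) (exists_pair hk (S (selI hl S))).choose.1 = false ∧
      S (selI hl S) (exists_pair hk (S (selI hl S))).choose.2 = false ∧
        cnt (S (selI hl S)) = 0) := by
    intro S
    obtain ⟨_, g2, g1, g0⟩ := (exists_pair hk (S (selI hl S))).choose_spec
    rcases lt_trichotomy (cnt (S (selI hl S))) 1 with h | h | h
    · have h : cnt (S (selI hl S)) = 0 := by omega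
      right; right
      exact ⟨(g0 h).1, (g0 h).2, h⟩
    · right; left
      exact ⟨(g1 h).1, (g1 h).2, h⟩
    · left
      exact ⟨(g2 h).1, (g2 h).2, h⟩
  cases a <;> cases b
  · refine (up_mono ?_).trans (h0.trans (by simp [qf]))
    rintro S ⟨ha, hb⟩
    rcases spec S with ⟨h, h', h''⟩ | ⟨h, h', h''⟩ | ⟨h, h', h''⟩ <;> rw [ha] at h <;>
      rw [hb] at h' <;> first | exact h'' | (exfalso; revert h; decide) | (exfalso; revert h'; decide)
  · have : (fun S : Fin l → Fin k → Bool =>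
      S (selI hl S) (exists_pair hk (S (selI hl S))).choose.1 = false ∧
      S (selI hl S) (exists_pair hk (S (selI hl S))).choose.2 = true) = fun _ => False := by
      funext S
      apply propext
      simp only [iff_false]
      rintro ⟨ha, hb⟩
      rcases spec S with ⟨h, h', h''⟩ | ⟨h, h', h''⟩ | ⟨h, h', h''⟩ <;> rw [ha] at h <;>
      rw [hb] at h' <;> first | exact h'' | (exfalso; revert h; decide) | (exfalso; revert h'; decide)
    rw [this]
    simp [unifProb, qf]
  · refine (up_mono ?_).trans (h1.trans (by simp [qf]))
    rintro S ⟨ha, hb⟩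
    rcases spec S with ⟨h, h', h''⟩ | ⟨h, h', h''⟩ | ⟨h, h', h''⟩ <;> rw [ha] at h <;>
      rw [hb] at h' <;> first | exact h'' | (exfalso; revert h; decide) | (exfalso; revert h'; decide)
  · refine (up_mono ?_).trans (h2.trans (by simp [qf]))
    rintro S ⟨ha, hb⟩
    rcases spec S with ⟨h, h', h''⟩ | ⟨h, h', h''⟩ | ⟨h, h', h''⟩ <;> rw [ha] at h <;>
      rw [hb] at h' <;> first | exact h'' | (exfalso; revert h; decide) | (exfalso; revert h'; decide)

lemma up_cl2 {n k l : ℕ} (hn : k ≤ n) (hk : 2 ≤ k) (hl : 0 < l) (a b : Lit n) :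
    unifProb (fun x : (Fin l → (Fin k ↪ Fin n)) × (Fin l → Fin k → Bool) => cl2 hk hl x = (a, b))
      ≤ qf k l a.2 b.2 / (n * (n - 1)) := by
  have : Nonempty (Fin k ↪ Fin n) := ⟨Fin.castLEEmb hn⟩
  have hn1 : (0 : ℝ) < n - 1 := by
    have : (2 : ℝ) ≤ n := by exact_mod_cast hk.trans hn
    linarith
  have hn0 : (0 : ℝ) < n := by linarith
  have key := up_prod_le (α := Fin l → (Fin k ↪ Fin n)) (β := Fin l → Fin k → Bool)
    (fun S => S (selI hl S) (exists_pair hk (S (selI hl S))).choose.1 = a.2 ∧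
      S (selI hl S) (exists_pair hk (S (selI hl S))).choose.2 = b.2)
    (fun S e => e (selI hl S) (exists_pair hk (S (selI hl S))).choose.1 = a.1 ∧
      e (selI hl S) (exists_pair hk (S (selI hl S))).choose.2 = b.1) (1 / (n * (n - 1))) (by
      intro S _
      have h1 := up_pi_inj (α := Fin k ↪ Fin n) (fun _ : Unit => selI hl S)
        (fun _ _ _ => rfl) (fun _ e =>
        e (exists_pair hk (S (selI hl S))).choose.1 = a.1 ∧
        e (exists_pair hk (S (selI hl S))).choose.2 = b.1)
      simp only [forall_const, Finset.univ_unique, Finset.prod_singleton] at h1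
      rw [h1]
      exact up_emb (hk.trans hn) _ _ (exists_pair hk (S (selI hl S))).choose_spec.1 _ _)
  refine (up_mono ?_).trans (key.trans ?_)
  · intro x hx
    unfold cl2 at hx
    simp only [Prod.ext_iff] at hx
    tauto
  · rw [mul_one_div]
    gcongr
    exact up_type hk hl _ _

lemma uf_X {n k l m : ℕ} : UF (fun (A : Fin m → (Fin l → (Fin k ↪ Fin n)) × (Fin l → Fin k → Bool))
    (i : Fin m) (t : Fin l) => toCl ((A i).1 t, (A i).2 t)) := by
  have h1 : UF (fun (b : Fin l → (Fin k ↪ Fin n) × (Fin k → Bool)) t => toCl (b t)) := uf_toCl.pi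
  have h2 := h1.comp_equiv (Equiv.arrowProdEquivProdArrow (Fin l) (fun _ => Fin k ↪ Fin n)
    (fun _ => Fin k → Bool)).symm
  exact h2.pi

lemma sat_of_twosat {n k l m : ℕ} (hk : 2 ≤ k) (hl : 0 < l)
    (A : Fin m → (Fin l → (Fin k ↪ Fin n)) × (Fin l → Fin k → Bool))
    (h : ∃ σ : Fin n → Bool, ∀ i, σ (cl2 hk hl (A i)).1.1 = (cl2 hk hl (A i)).1.2 ∨
      σ (cl2 hk hl (A i)).2.1 = (cl2 hk hl (A i)).2.2) :
    Satisfiable (fun i => select hl (fun t => toCl ((A i).1 t, (A i).2 t))) := by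
  obtain ⟨σ, hσ⟩ := h
  refine ⟨σ, fun i => ?_⟩
  simp only
  rw [select_eq]
  rcases hσ i with h | h
  · exact ⟨(cl2 hk hl (A i)).1, mem_image.2 ⟨_, mem_univ _, rfl⟩, h⟩
  · exact ⟨(cl2 hk hl (A i)).2, mem_image.2 ⟨_, mem_univ _, rfl⟩, h⟩

lemma up_unsat_le {n k l m : ℕ} (hk : 2 ≤ k) (hl : 0 < l) (hn : k ≤ n) :
    1 - unifProb (fun A : Fin m → (Fin l → (Fin k ↪ Fin n)) × (Fin l → Fin k → Bool) =>
      ¬ ∃ σ : Fin n → Bool, ∀ i, σ (cl2 hk hl (A i)).1.1 = (cl2 hk hl (A i)).1.2 ∨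
      σ (cl2 hk hl (A i)).2.1 = (cl2 hk hl (A i)).2.2) ≤
    unifProb (fun A : Fin m → Fin l → Clause n k => Satisfiable (fun i => select hl (A i))) ∧
    unifProb (fun A : Fin m → Fin l → Clause n k => Satisfiable (fun i => select hl (A i))) ≤ 1 := by
  have : Nonempty (Fin k ↪ Fin n) := ⟨Fin.castLEEmb hn⟩
  rw [uf_X.up, ← up_compl]
  constructor
  · apply up_mono
    intro A hA
    exact sat_of_twosat hk hl A hA
  · rw [up_compl]
    linarith [up_nonneg (fun A : Fin m → (Fin l → (Fin k ↪ Fin n)) × (Fin l → Fin k → Bool) =>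
        ¬ Satisfiable (fun i => select hl (fun t => toCl ((A i).1 t, (A i).2 t))))]

end final

/-- For all integers `k ≥ 2`, `l ≥ 2`, the `l`-clause Achlioptas rule `select` for random
`k`-SAT is such that for every `ε > 0`, the formula generated after `⌊(r(k,l) - ε) * n⌋`
steps is satisfiable with probability tending to `1` as `n → ∞`. -/
theorem achlioptas_ksat_delay (k l : ℕ) (hk : 2 ≤ k) (hl : 2 ≤ l) (ε : ℝ) (hε : 0 < ε) :
    Tendsto (fun n : ℕ =>
        unifProb (fun A : Fin (⌊(rkl k l - ε) * n⌋₊) → Fin l → Clause n k =>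
          Satisfiable (fun i => select (by omega) (A i))))
      atTop (nhds 1) := by
  have hl0 : 0 < l := by omega
  have h2k : (0 : ℝ) < 2 ^ k := by positivity
  have hkk : k + 1 < 2 ^ k := by
    induction k, hk using Nat.le_induction with
    | base => norm_num
    | succ k _ ih =>
      have := ih (by positivity)
      rw [pow_succ]; omega
  have hp0 : (0 : ℝ) < (k + 1 : ℝ) / 2 ^ k := by positivity
  have hp1 : (k + 1 : ℝ) / 2 ^ k < 1 := by
    rw [div_lt_one h2k]; exact_mod_cast hkk
  have hpl : ((k + 1 : ℝ) / 2 ^ k) ^ l < 1 := pow_lt_one₀ hp0.le hp1 (by omega)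
  have hpl1 : ((k + 1 : ℝ) / 2 ^ k) ^ (l - 1) ≤ 1 := pow_le_one₀ hp0.le hp1.le
  have hq2 : 0 < qf k l true true := by simp only [qf]; linarith
  have hq0 : 0 < qf k l false false := by simp only [qf]; positivity
  have hQ0 : ∀ a b, 0 ≤ qf k l a b := by
    intro a b
    cases a <;> cases b
    · exact hq0.le
    · exact le_rfl
    · simp only [qf]; positivity
    · exact hq2.le
  have hQ1 : ∀ a b, qf k l a b ≤ 1 := by
    intro a b
    cases a <;> cases b <;> simp only [qf]
    · apply mul_le_one₀ hpl1 (by positivity)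
      rw [div_le_one h2k]
      exact_mod_cast Nat.one_le_two_pow
    · exact zero_le_one
    · apply mul_le_one₀ hpl1 (by positivity)
      rw [div_le_one h2k]
      exact_mod_cast (by omega : k ≤ 2 ^ k)
    · have : 0 < ((k + 1 : ℝ) / 2 ^ k) ^ l := by positivity
      linarith
  obtain ⟨lam, hlamdef⟩ : ∃ lam, lam = qf k l true false
    + 2 * Real.sqrt (qf k l false false * qf k l true true) := ⟨_, rfl⟩
  have hrkl : rkl k l = 1 / lam := by
    rw [hlamdef]; rfl
  have hlam : 0 < lam := by
    rw [hlamdef]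
    have := hQ0 true false
    have : 0 < Real.sqrt (qf k l false false * qf k l true true) :=
      Real.sqrt_pos.2 (mul_pos hq0 hq2)
    linarith
  let κ : Bool → ℝ := fun b => if b then Real.sqrt (qf k l true true)
    else Real.sqrt (qf k l false false)
  have hκt : κ true = Real.sqrt (qf k l true true) := rfl
  have hκf : κ false = Real.sqrt (qf k l false false) := rfl
  have hκ : ∀ b, κ true * (qf k l false b + qf k l b false)
      + κ false * (qf k l true b + qf k l b true) = lam * κ b := by
    have s0 := Real.mul_self_sqrt hq0.le
    have s2 := Real.mul_self_sqrt hq2.le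
    have hft : qf k l false true = 0 := rfl
    intro b
    cases b
    · rw [hκt, hκf, hlamdef, Real.sqrt_mul hq0.le, hft]
      linear_combination (-2 * Real.sqrt (qf k l true true)) * s0
    · rw [hκt, hκf, hlamdef, Real.sqrt_mul hq0.le, hft]
      linear_combination (-2 * Real.sqrt (qf k l false false)) * s2
  obtain ⟨c, hcdef⟩ : ∃ c, c = max (rkl k l - ε / 2) 0 := ⟨_, rfl⟩
  have hc0 : 0 ≤ c := by rw [hcdef]; exact le_max_right _ _
  have hr0 : 0 < rkl k l := by rw [hrkl]; positivity
  have hclam : c * lam < 1 := by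
    have : c < 1 / lam := by
      rw [hcdef, ← hrkl]
      apply max_lt <;> linarith
    rwa [lt_div_iff₀ hlam] at this
  have hclam0 : 0 ≤ c * lam := by positivity
  have hsum : Summable (fun s : ℕ => (s + 1 : ℝ) ^ 2 * (c * lam) ^ s) := by
    have hx : ‖c * lam‖ < 1 := by rwa [Real.norm_of_nonneg hclam0]
    have a2 := summable_pow_mul_geometric_of_norm_lt_one 2 hx
    have a1 := summable_pow_mul_geometric_of_norm_lt_one 1 hx
    have a0 := summable_pow_mul_geometric_of_norm_lt_one 0 hx
    refine ((a2.add (a1.mul_left 2)).add a0).congr (fun s => ?_)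
    ring
  obtain ⟨κ0, hκ0def⟩ : ∃ κ0, κ0 = min (κ true) (κ false) := ⟨_, rfl⟩
  have hκtp : 0 < κ true := Real.sqrt_pos.2 hq2
  have hκfp : 0 < κ false := Real.sqrt_pos.2 hq0
  have hκ0 : 0 < κ0 := by rw [hκ0def]; exact lt_min hκtp hκfp
  have hκκ : ∀ b, κ0 ≤ κ b := by
    intro b
    rw [hκ0def]
    cases b
    · exact min_le_right _ _
    · exact min_le_left _ _
  obtain ⟨B, hB⟩ : ∃ B, B = (∑' s : ℕ, (s + 1 : ℝ) ^ 2 * (c * lam) ^ s)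
        * (8 * c ^ 2 * ((κ true + κ false) / κ0)) := ⟨_, rfl⟩
  have hlim : Tendsto (fun n : ℕ => 1 - B / (n : ℝ)) atTop (nhds 1) := by
    have := (tendsto_const_div_atTop_nhds_zero_nat B).const_sub 1
    simpa using this
  have main : ∀ᶠ n : ℕ in atTop, 1 - B / (n : ℝ) ≤ unifProb (fun A : Fin (⌊(rkl k l - ε) * n⌋₊) →
      Fin l → Clause n k => Satisfiable (fun i => select hl0 (A i))) ∧
      unifProb (fun A : Fin (⌊(rkl k l - ε) * n⌋₊) →
      Fin l → Clause n k => Satisfiable (fun i => select hl0 (A i))) ≤ 1 := by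
    filter_upwards [eventually_ge_atTop k, eventually_ge_atTop ⌈2 * rkl k l / ε⌉₊] with n hnk hnr
    have hnr : 2 * rkl k l / ε ≤ n := Nat.ceil_le.1 hnr
    rw [div_le_iff₀ hε] at hnr
    have hn2 : (2 : ℝ) ≤ n := by exact_mod_cast hk.trans hnk
    have hm : ((⌊(rkl k l - ε) * n⌋₊ : ℕ) : ℝ) ≤ c * (n - 1) := by
      by_cases hpos : 0 ≤ (rkl k l - ε) * n
      · refine (Nat.floor_le hpos).trans ?_
        have h1 : (rkl k l - ε / 2) * (n - 1) ≤ c * (n - 1) := by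
          apply mul_le_mul_of_nonneg_right _ (by linarith)
          rw [hcdef]; exact le_max_left _ _
        nlinarith
      · rw [Nat.floor_of_nonpos (le_of_not_ge hpos)]
        simp only [Nat.cast_zero]
        apply mul_nonneg hc0; linarith
    generalize ⌊(rkl k l - ε) * n⌋₊ = m at *
    have : Nonempty (Fin k ↪ Fin n) := ⟨Fin.castLEEmb hnk⟩
    have hfm := first_moment n m (hk.trans hnk) (cl2 (n := n) hk hl0) (qf k l) hQ0 hQ1
      (up_cl2 hnk hk hl0) κ κ0 hκ0 hκκ lam hκ hlam c hc0 hm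
    have hmono := up_unsat_le (m := m) hk hl0 hnk
    have hle : (∑ s ∈ range n, (s + 1 : ℝ) ^ 2 * (c * lam) ^ s)
        * (8 * c ^ 2 * ((κ true + κ false) / κ0)) / n ≤ B / n := by
      rw [hB]
      gcongr
      exact hsum.sum_le_tsum _ (fun s _ => by positivity)
    exact ⟨by linarith [hfm.trans hle, hmono.1], hmono.2⟩
  exact tendsto_of_tendsto_of_tendsto_of_le_of_le' hlim tendsto_const_nhds
    (main.mono fun n h => h.1) (main.mono fun n h => h.2)
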